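/- For m ≥ 5 alternatives, there is no SDS on the domain of strict preference profiles with variable electorates that is pairwise, neutral, weakly strategyproof, and ex post efficient. -/

import Mathlib

open Classical Finset

structure StrictPref (A : Type*) where
  rel : A → A → Prop
  trans : ∀ {a b c}, rel a b → rel b c → rel a c
  irrefl : ∀ a, ¬ rel a a
  total : ∀ a b, a ≠ b → rel a b ∨ rel b a

variable {A : Type*} [Fintype A]

noncomputable def probUC (p : A → ℝ) (r : A → A → Prop) (x : A) : ℝ :=
  ∑ y ∈ Finset.univ.filter (fun y => y = x ∨ r y x), p y

def SD (r : A → A → Prop) (p q : A → ℝ) : Prop :=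
  ∀ x, probUC q r x ≤ probUC p r x

def StrictSD (r : A → A → Prop) (p q : A → ℝ) : Prop :=
  SD r p q ∧ ∃ x, probUC q r x < probUC p r x

def IsLottery (p : A → ℝ) : Prop := (∀ a, 0 ≤ p a) ∧ ∑ a, p a = 1

/-- An SDS on the domain of strict preference profiles with variable (finite, nonempty)
electorates `N ⊆ ℕ`. -/
def VarSDS (A : Type*) : Type _ := (N : Finset ℕ) → ((i : ℕ) → i ∈ N → StrictPref A) → A → ℝ

/-- Majority margin of `x` over `y` in the profile `R` with electorate `N`. -/
noncomputable def margin (N : Finset ℕ) (R : (i : ℕ) → i ∈ N → StrictPref A) (x y : A) : ℤ :=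
  ((N.attach.filter (fun i => (R i.1 i.2).rel x y)).card : ℤ) -
    ((N.attach.filter (fun i => (R i.1 i.2).rel y x)).card : ℤ)

/-- `f` is pairwise: its outcome only depends on the pairwise majority margins. -/
def Pairwise' (f : VarSDS A) : Prop :=
  ∀ (N N' : Finset ℕ), N.Nonempty → N'.Nonempty →
    ∀ (R : (i : ℕ) → i ∈ N → StrictPref A) (R' : (i : ℕ) → i ∈ N' → StrictPref A),
      (∀ x y, margin N R x y = margin N' R' x y) → f N R = f N' R'

/-- Weak strategyproofness for variable electorates: within any fixed electorate, no
voter can obtain a strictly stochastically dominant lottery by misreporting. -/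
def VarWeakSP (f : VarSDS A) : Prop :=
  ∀ (N : Finset ℕ), N.Nonempty →
    ∀ (R R' : (i : ℕ) → i ∈ N → StrictPref A) (i : ℕ) (hi : i ∈ N),
      (∀ j (hj : j ∈ N), j ≠ i → R j hj = R' j hj) →
      ¬ StrictSD (R i hi).rel (f N R') (f N R)

/-- `R'` is obtained from `R` by voter `i` swapping the adjacent pair `x ≻ᵢ y`
to `y ≻ᵢ x` (reinforcing `y` against `x`). -/
def VarAdjSwap (N : Finset ℕ) (R : (i : ℕ) → i ∈ N → StrictPref A) (i : ℕ) (hi : i ∈ N)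
    (x y : A) (R' : (i : ℕ) → i ∈ N → StrictPref A) : Prop :=
  x ≠ y ∧ (R i hi).rel x y ∧ (¬ ∃ z, (R i hi).rel x z ∧ (R i hi).rel z y) ∧
  (∀ j (hj : j ∈ N), j ≠ i → R j hj = R' j hj) ∧ (R' i hi).rel y x ∧
  (∀ a b, ¬(a = x ∧ b = y) → ¬(a = y ∧ b = x) →
    ((R i hi).rel a b ↔ (R' i hi).rel a b))

def StrictPref.permute (π : Equiv.Perm A) (r : StrictPref A) : StrictPref A where
  rel a b := r.rel (π.symm a) (π.symm b)
  trans h1 h2 := r.trans h1 h2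
  irrefl a := r.irrefl _
  total a b h := r.total _ _ (π.symm.injective.ne h)

def VarNeutral (f : VarSDS A) : Prop :=
  ∀ (π : Equiv.Perm A) (N : Finset ℕ), N.Nonempty →
    ∀ (R : (i : ℕ) → i ∈ N → StrictPref A) (x : A),
      f N (fun i hi => (R i hi).permute π) (π x) = f N R x

def VarExPostEfficient (f : VarSDS A) : Prop :=
  ∀ (N : Finset ℕ), N.Nonempty → ∀ (R : (i : ℕ) → i ∈ N → StrictPref A) (x : A),
    (∃ y, ∀ i (hi : i ∈ N), (R i hi).rel y x) → f N R x = 0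

/-- The strict preference ranking alternatives by increasing value of an injective function. -/
def StrictPref.ofRank {A : Type*} (r : A → ℤ) (hr : Function.Injective r) : StrictPref A where
  rel x y := r x < r y
  trans h₁ h₂ := lt_trans h₁ h₂
  irrefl _ := lt_irrefl _
  total _ _ h := lt_or_gt_of_ne (hr.ne h)

theorem StrictPref.asymm {A : Type*} (P : StrictPref A) {x y : A} (h : P.rel x y) :
    ¬ P.rel y x :=
  fun h' => P.irrefl _ (P.trans h h')

/-- The profile with electorate `{0, 1}` in which voter `0` reports `P` and voter `1` reports
`Q`. -/
def twoVoters {A : Type*} (P Q : StrictPref A) (i : ℕ) (_ : i ∈ ({0, 1} : Finset ℕ)) :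
    StrictPref A :=
  if i = 0 then P else Q

theorem card_filter_twoVoters {A : Type*} (P Q : StrictPref A) (x y : A) :
    ((({0, 1} : Finset ℕ).attach.filter
        (fun i => (twoVoters P Q i.1 i.2).rel x y)).card : ℤ) =
      (if P.rel x y then 1 else 0) + (if Q.rel x y then 1 else 0) := by
  have := Finset.sum_attach ({0, 1} : Finset ℕ)
    (fun i => if (if i = 0 then P else Q).rel x y then 1 else 0)
  rw [Finset.sum_pair zero_ne_one] at this
  rw [Finset.card_filter]
  exact_mod_cast this

theorem margin_twoVoters_congr {A : Type*} {P Q P' Q' : StrictPref A}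
    (h : ∀ x y, (P.rel x y ∧ Q.rel x y) ↔ (P'.rel x y ∧ Q'.rel x y)) (x y : A) :
    margin {0, 1} (twoVoters P Q) x y = margin {0, 1} (twoVoters P' Q') x y := by
  unfold margin
  simp only [card_filter_twoVoters]
  rcases eq_or_ne x y with rfl | hxy
  · ring
  have h₁ := h x y
  have h₂ := h y x
  rcases P.total x y hxy with a | a <;> rcases Q.total x y hxy with b | b <;>
    rcases P'.total x y hxy with c | c <;> rcases Q'.total x y hxy with d | d <;>
    simp_all [P.asymm a, Q.asymm b, P'.asymm c, Q'.asymm d]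

/-- If the probability gains `q - p` are nonnegative throughout an upper contour set, or
nonpositive throughout its complement, for every upper contour set, then `q` dominates `p`. -/
theorem SD.of_single_crossing {A : Type*} [Fintype A] {r : A → A → Prop} {p q : A → ℝ}
    (hsum : ∑ y, p y = ∑ y, q y)
    (h : ∀ x, (∀ y, (y = x ∨ r y x) → p y ≤ q y) ∨ (∀ y, ¬ (y = x ∨ r y x) → q y ≤ p y)) :
    SD r q p := by
  intro x
  unfold probUC
  rcases h x with h | h
  · exact Finset.sum_le_sum fun y hy => h y (Finset.mem_filter.1 hy).2
  · have hp := Finset.sum_filter_add_sum_filter_not univ (fun y => y = x ∨ r y x) p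
    have hq := Finset.sum_filter_add_sum_filter_not univ (fun y => y = x ∨ r y x) q
    have := Finset.sum_le_sum (s := univ.filter fun y => ¬ (y = x ∨ r y x)) (f := q) (g := p)
      fun y hy => h y (Finset.mem_filter.1 hy).2
    linarith

section TwoVoters

variable {A : Type*} {f : VarSDS A} {P Q P' Q' : StrictPref A}

theorem Pairwise'.twoVoters_congr (hf : Pairwise' f)
    (h : ∀ x y, (P.rel x y ∧ Q.rel x y) ↔ (P'.rel x y ∧ Q'.rel x y)) :
    f {0, 1} (twoVoters P Q) = f {0, 1} (twoVoters P' Q') :=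
  hf _ _ (by simp) (by simp) _ _ (margin_twoVoters_congr h)

/-- A permutation of the alternatives carrying the Pareto relation of one two-voter profile to
that of another carries the first outcome to the second. -/
theorem VarNeutral.twoVoters_apply (hn : VarNeutral f) (hf : Pairwise' f) (π : Equiv.Perm A)
    (h : ∀ x y, (P'.rel (π x) (π y) ∧ Q'.rel (π x) (π y)) ↔ (P.rel x y ∧ Q.rel x y)) (x : A) :
    f {0, 1} (twoVoters P' Q') (π x) = f {0, 1} (twoVoters P Q) x := by
  rw [← hn π {0, 1} (by simp) (twoVoters P Q) x]
  have e : (fun i hi => (twoVoters P Q i hi).permute π) =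
      twoVoters (P.permute π) (Q.permute π) := by
    funext i hi
    unfold twoVoters
    split_ifs <;> rfl
  rw [e]
  refine congrFun (hf.twoVoters_congr fun a b => ?_) _
  simpa [StrictPref.permute] using h (π.symm a) (π.symm b)

theorem VarWeakSP.not_strictSD_twoVoters [Fintype A] (hs : VarWeakSP f) (P P' Q : StrictPref A) :
    ¬ StrictSD P.rel (f {0, 1} (twoVoters P' Q)) (f {0, 1} (twoVoters P Q)) := by
  refine hs {0, 1} (by simp) (twoVoters P Q) (twoVoters P' Q) 0 (by simp) fun j _ hj => ?_
  simp [twoVoters, hj]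

theorem VarExPostEfficient.twoVoters_eq_zero (he : VarExPostEfficient f) {x y : A}
    (hP : P.rel x y) (hQ : Q.rel x y) : f {0, 1} (twoVoters P Q) y = 0 := by
  refine he _ (by simp) _ _ ⟨x, fun i _ => ?_⟩
  unfold twoVoters
  split_ifs <;> assumption

end TwoVoters

/-- For `m ≥ 5` alternatives, no pairwise, neutral, and weakly strategyproof SDS on the
variable-electorate domain of strict preference profiles is ex post efficient. -/
theorem no_pairwise_neutral_weakSP_exPost (m : ℕ) (hm : 5 ≤ m) :
    ¬ ∃ f : VarSDS (Fin m),
        (∀ (N : Finset ℕ), N.Nonempty → ∀ R, IsLottery (f N R)) ∧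
        Pairwise' f ∧ VarNeutral f ∧ VarWeakSP f ∧ VarExPostEfficient f := by
  rintro ⟨f, hl, hp, hn, hs, he⟩
  obtain ⟨k, rfl⟩ : ∃ k, m = k + 4 := ⟨m - 4, by omega⟩
  obtain ⟨a, ha⟩ : ∃ a : Fin (k + 4), (a : ℕ) = 0 := ⟨⟨0, by omega⟩, rfl⟩
  obtain ⟨b, hb⟩ : ∃ b : Fin (k + 4), (b : ℕ) = 1 := ⟨⟨1, by omega⟩, rfl⟩
  obtain ⟨d, hd⟩ : ∃ d : Fin (k + 4), (d : ℕ) = k + 2 := ⟨⟨k + 2, by omega⟩, rfl⟩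
  obtain ⟨c, hc⟩ : ∃ c : Fin (k + 4), (c : ℕ) = k + 3 := ⟨⟨k + 3, by omega⟩, rfl⟩
  obtain ⟨I, hI⟩ : ∃ I : StrictPref (Fin (k + 4)), ∀ x y, I.rel x y ↔ x < y :=
    ⟨.ofRank (fun x => (x : ℤ)) fun x y h => by simpa [Fin.ext_iff] using h,
      fun x y => by simp [StrictPref.ofRank]⟩
  obtain ⟨V, hV⟩ : ∃ V : StrictPref (Fin (k + 4)), ∀ x y, V.rel x y ↔
      (if x = b then (1 : ℤ) else -(x : ℤ)) < if y = b then (1 : ℤ) else -(y : ℤ) :=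
    ⟨.ofRank (fun x => if x = b then (1 : ℤ) else -(x : ℤ)) fun x y h => by
      simp only [Fin.ext_iff, hb] at h
      split_ifs at h <;> omega, fun _ _ => Iff.rfl⟩
  obtain ⟨U, hU⟩ : ∃ U : StrictPref (Fin (k + 4)), ∀ x y, U.rel x y ↔
      (if x = b then (k + 4 : ℤ) else (x : ℤ)) < if y = b then (k + 4 : ℤ) else (y : ℤ) :=
    ⟨.ofRank (fun x => if x = b then (k + 4 : ℤ) else (x : ℤ)) fun x y h => by
      simp only [Fin.ext_iff, hb] at h
      split_ifs at h <;> omega, fun _ _ => Iff.rfl⟩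
  obtain ⟨W, hW⟩ : ∃ W : StrictPref (Fin (k + 4)), ∀ x y, W.rel x y ↔
      (if x = a then (1 : ℤ) else if x = b then 0 else
        if x = d then k + 3 else if x = c then k + 2 else (x : ℤ)) <
      (if y = a then (1 : ℤ) else if y = b then 0 else
        if y = d then k + 3 else if y = c then k + 2 else (y : ℤ)) :=
    ⟨.ofRank (fun x => if x = a then (1 : ℤ) else if x = b then 0 else
      if x = d then k + 3 else if x = c then k + 2 else (x : ℤ)) fun x y h => by
      simp only [Fin.ext_iff, ha, hb, hc, hd] at h
      split_ifs at h <;> omega, fun _ _ => Iff.rfl⟩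
  have paretoI : ∀ x y, (I.rel x y ∧ V.rel x y) ↔ (x = a ∧ y = b) := by
    intro x y
    simp only [hI, hV, Fin.lt_def, Fin.ext_iff, ha, hb]
    split_ifs <;> omega
  have paretoU : ∀ x y, (U.rel x y ∧ V.rel x y) ↔ (x ≠ b ∧ y = b) := by
    intro x y
    simp only [hU, hV, ne_eq, Fin.ext_iff, hb]
    split_ifs <;> omega
  have paretoW : ∀ x y, (W.rel x y ∧ V.rel x y) ↔ (x = c ∧ y = d) := by
    intro x y
    simp only [hW, hV, Fin.ext_iff, ha, hb, hc, hd]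
    split_ifs <;> omega
  have hab : a ≠ b := by rw [ne_eq, Fin.ext_iff]; omega
  have U_top : ∀ y, ¬ U.rel y a := by
    intro y
    rw [hU, if_neg hab, ha]
    split_ifs <;> omega
  have hca : c ≠ a := by rw [ne_eq, Fin.ext_iff]; omega
  have hcb : c ≠ b := by rw [ne_eq, Fin.ext_iff]; omega
  have hda : d ≠ a := by rw [ne_eq, Fin.ext_iff]; omega
  have hdb : d ≠ b := by rw [ne_eq, Fin.ext_iff]; omega
  have hcd : c ≠ d := by rw [ne_eq, Fin.ext_iff]; omega
  set p := f {0, 1} (twoVoters I V) with hp_def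
  set u := f {0, 1} (twoVoters U V) with hu_def
  set q := f {0, 1} (twoVoters W V) with hq_def
  obtain ⟨-, p_sum⟩ := hl {0, 1} (by simp) (twoVoters I V)
  obtain ⟨-, u_sum⟩ := hl {0, 1} (by simp) (twoVoters U V)
  obtain ⟨-, q_sum⟩ := hl {0, 1} (by simp) (twoVoters W V)
  rw [← hp_def] at p_sum
  rw [← hu_def] at u_sum
  rw [← hq_def] at q_sum
  have p_b : p b = 0 :=
    he.twoVoters_eq_zero ((paretoI a b).2 ⟨rfl, rfl⟩).1 ((paretoI a b).2 ⟨rfl, rfl⟩).2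
  have u_b : u b = 0 :=
    he.twoVoters_eq_zero ((paretoU a b).2 ⟨hab, rfl⟩).1 ((paretoU a b).2 ⟨hab, rfl⟩).2
  have p_const : ∀ x, x ≠ a → x ≠ b → p x = p c := by
    intro x hxa hxb
    have := hn.twoVoters_apply hp (P := I) (Q := V) (P' := I) (Q' := V) (Equiv.swap x c)
      (by simp only [paretoI]; intro y z; grind) c
    simpa using this
  have u_const : ∀ x, x ≠ b → u x = u a := by
    intro x hxb
    have := hn.twoVoters_apply hp (P := U) (Q := V) (P' := U) (Q' := V) (Equiv.swap x a)
      (by simp only [paretoU]; intro y z; grind) a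
    simpa using this
  have q_apply : ∀ x, q ((Equiv.swap a c * Equiv.swap b d) x) = p x :=
    hn.twoVoters_apply hp _ (by
      simp only [paretoI, paretoW, Equiv.Perm.mul_apply]
      intro y z
      grind)
  have q_c : q c = p a := by
    rw [← q_apply a]
    simp [Equiv.swap_apply_of_ne_of_ne hab hda.symm]
  have q_const : ∀ x, x ≠ c → x ≠ d → q x = p c := by
    intro x hxc hxd
    rw [← p_const ((Equiv.swap a c * Equiv.swap b d).symm x), ← q_apply, Equiv.apply_symm_apply]
    all_goals
      rw [ne_eq, Equiv.symm_apply_eq, Equiv.Perm.mul_apply]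
      grind
  have p_total : p a + (k + 2) * p c = 1 := by
    rw [← p_sum, ← add_sum_erase univ p (mem_univ a),
      ← add_sum_erase (univ.erase a) p (mem_erase.2 ⟨hab.symm, mem_univ b⟩), p_b,
      sum_congr rfl (g := fun _ => p c) fun x hx => p_const x (by grind) (by grind)]
    simp [card_erase_of_mem, hab.symm]
  have u_total : (k + 3) * u a = 1 := by
    rw [← u_sum, ← add_sum_erase univ u (mem_univ b), u_b,
      sum_congr rfl (g := fun _ => u a) fun x hx => u_const x (by grind)]
    simp [card_erase_of_mem]
  have p_a_le : p a ≤ p c := by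
    by_contra! hlt
    have hua : u a < p a := by nlinarith
    have huc : p c < u a := by nlinarith
    refine hs.not_strictSD_twoVoters U I V
      ⟨SD.of_single_crossing (u_sum.trans p_sum.symm) fun x => Or.inr fun y hy => ?_, a, ?_⟩
    · have hya : y ≠ a := by
        rintro rfl
        refine hy ((eq_or_ne y x).imp id fun hyx => ?_)
        exact (U.total y x hyx).resolve_right (U_top x)
      by_cases hyb : y = b
      · exact hyb ▸ (p_b.trans u_b.symm).le
      · exact (p_const y hya hyb).trans_le (huc.le.trans_eq (u_const y hyb).symm)
    · simp only [probUC, U_top, or_false, filter_eq', mem_univ, if_true, sum_singleton]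
      exact hua
  have p_c_pos : 0 < p c := by
    by_contra! h
    nlinarith
  refine hs.not_strictSD_twoVoters I W V
    ⟨SD.of_single_crossing (p_sum.trans q_sum.symm) fun x => ?_, b, ?_⟩
  · simp only [← hp_def, ← hq_def, hI, ← le_iff_eq_or_lt]
    by_cases hx : (x : ℕ) < k + 2
    · refine Or.inl fun y hy => ?_
      rw [Fin.le_def] at hy
      rw [q_const y (by rw [ne_eq, Fin.ext_iff]; omega) (by rw [ne_eq, Fin.ext_iff]; omega)]
      by_cases hya : y = a
      · rwa [hya]
      by_cases hyb : y = b
      · rw [hyb, p_b]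
        exact p_c_pos.le
      · exact (p_const y hya hyb).le
    · refine Or.inr fun y hy => ?_
      rw [Fin.le_def] at hy
      obtain rfl : y = c := by rw [Fin.ext_iff]; omega
      rwa [q_c]
  · have probUC_b : ∀ g, probUC g I.rel b = g a + g b := by
      intro g
      rw [probUC, ← sum_pair hab]
      congr 1
      ext y
      simp only [hI, mem_filter, mem_univ, true_and, mem_singleton, mem_insert, Fin.lt_def,
        Fin.ext_iff, ha, hb]
      omega
    rw [← hp_def, ← hq_def, probUC_b, probUC_b, p_b, q_const a hca.symm hda.symm, q_const b hcb.symm hdb.symm]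
    linarith
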